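/- Let T = X + iY satisfy assumption (A) and let α, ψ, φ, β be polynomials with complex coefficients. Then [α(X)ψ(Y), φ(X)] and [α(X)ψ(Y), β(Y)] are trace-class operators, and −i Tr([α(X)ψ(Y), φ(X)]) = ∫_{[a,b]²} α(t) φ′(t) ψ′(λ) r(t, λ) dt dλ = ∫_{[a,b]²} −J(αψ, φ)(t, λ) r(t, λ) dt dλ, while −i Tr([α(X)ψ(Y), β(Y)]) = −∫_{[a,b]²} α′(t) ψ(λ) β′(λ) r(t, λ) dt dλ = ∫_{[a,b]²} −J(αψ, β)(t, λ) r(t, λ) dt dλ. -/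

import Mathlib

open scoped InnerProductSpace
open MeasureTheory Polynomial

namespace HHCP

variable {H : Type*} [NormedAddCommGroup H] [InnerProductSpace ℂ H] [CompleteSpace H]
  [TopologicalSpace.SeparableSpace H]

/-- `f(A)` for a function `f` of a real variable, applied to the (selfadjoint, hence
star-normal) bounded operator `A` via the continuous functional calculus. -/
noncomputable def fc (f : ℝ → ℂ) (A : H →L[ℂ] H) : H →L[ℂ] H :=
  cfc (fun z : ℂ => f z.re) A

/-- `|A| = √(A⋆A)`. -/
noncomputable def absOp (A : H →L[ℂ] H) : H →L[ℂ] H :=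
  cfc Real.sqrt (ContinuousLinearMap.adjoint A * A)

/-- `A` is of trace class, i.e. `∑ ⟪eᵢ, |A| eᵢ⟫ < ∞` (this is independent of the
choice of the Hilbert basis `e`). -/
def IsTraceClass {ι : Type*} (e : HilbertBasis ι ℂ H) (A : H →L[ℂ] H) : Prop :=
  Summable fun i => (⟪e i, absOp A (e i)⟫_ℂ).re

/-- The trace norm `‖A‖₁ = Tr |A|`. -/
noncomputable def traceNorm {ι : Type*} (e : HilbertBasis ι ℂ H) (A : H →L[ℂ] H) : ℝ :=
  ∑' i, (⟪e i, absOp A (e i)⟫_ℂ).re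

/-- The trace `Tr A = ∑ᵢ ⟪eᵢ, A eᵢ⟫`. -/
noncomputable def trace {ι : Type*} (e : HilbertBasis ι ℂ H) (A : H →L[ℂ] H) : ℂ :=
  ∑' i, ⟪e i, A (e i)⟫_ℂ

/-- `T` is hyponormal (`‖T⋆x‖ ≤ ‖Tx‖`, i.e. `[T⋆,T] ≥ 0`) and *purely* so: there is no
nonzero closed subspace, invariant under `T` and `T⋆`, on which `T` is normal. -/
def PurelyHyponormal (T : H →L[ℂ] H) : Prop :=
  (∀ x : H, ‖ContinuousLinearMap.adjoint T x‖ ≤ ‖T x‖) ∧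
  ∀ S : Submodule ℂ H, IsClosed (S : Set H) →
    (∀ x ∈ S, T x ∈ S) → (∀ x ∈ S, ContinuousLinearMap.adjoint T x ∈ S) →
    (∀ x ∈ S, ‖T x‖ = ‖ContinuousLinearMap.adjoint T x‖) → S = ⊥

/-- Assumption (A): `T = X + iY` is purely hyponormal with `X, Y` selfadjoint,
`[T⋆,T] = −2i[Y,X] = 2D²` is a positive trace-class operator, and
`σ(X) ∪ σ(Y) ⊆ [a,b]`. -/
structure AssumptionA {ι : Type*} (e : HilbertBasis ι ℂ H)
    (X Y D2 : H →L[ℂ] H) (a b : ℝ) : Prop where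
  hab : a ≤ b
  hX : IsSelfAdjoint X
  hY : IsSelfAdjoint Y
  hpure : PurelyHyponormal (X + Complex.I • Y)
  hD2 : (2 : ℂ) • D2 = (-(2 : ℂ) * Complex.I) • (Y * X - X * Y)
  hpos : D2.IsPositive
  htc : IsTraceClass e D2
  hspecX : spectrum ℝ X ⊆ Set.Icc a b
  hspecY : spectrum ℝ Y ⊆ Set.Icc a b

/-- `ψ ∈ C¹₁`: `ψ(β) = (2π)^{-1/2} ∫ ψ̂(α) e^{iαβ} dα` for some `ψ̂` with
`∫ |ψ̂(α)|(1+|α|) dα < ∞`. -/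
def MemC11 (ψ : ℝ → ℂ) : Prop :=
  ∃ g : ℝ → ℂ, Integrable g ∧ Integrable (fun α : ℝ => α • g α) ∧
    ∀ β : ℝ, ψ β = (Real.sqrt (2 * Real.pi))⁻¹ •
      ∫ α : ℝ, Complex.exp (Complex.I * (α : ℂ) * (β : ℂ)) • g α

/-- `ψ` is (the function given by) a polynomial with complex coefficients. -/
def IsPolyFun (ψ : ℝ → ℂ) : Prop :=
  ∃ p : Polynomial ℂ, ∀ t : ℝ, ψ t = Polynomial.eval (t : ℂ) p

/-- `ψ` is either in `C¹₁([a,b])` or a polynomial. -/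
def GoodFun (ψ : ℝ → ℂ) : Prop := MemC11 ψ ∨ IsPolyFun ψ

/-- `E` is the spectral measure of the selfadjoint operator `A`: a projection-valued,
countably additive measure on `ℝ` such that `⟪x, f(A) x⟫ = ∫ f dμ_x`, where `μ_x` is the
finite positive measure `μ_x(Δ) = ⟪x, E(Δ) x⟫`. -/
def IsSpectralMeasureOf (A : H →L[ℂ] H) (E : Set ℝ → H →L[ℂ] H) : Prop :=
  (∀ Δ : Set ℝ, IsSelfAdjoint (E Δ)) ∧
  (∀ Δ Ω : Set ℝ, E (Δ ∩ Ω) = E Δ * E Ω) ∧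
  E Set.univ = 1 ∧
  (∀ Δ : ℕ → Set ℝ, (∀ n, MeasurableSet (Δ n)) → Pairwise (Function.onFun Disjoint Δ) →
    ∀ x : H, HasSum (fun n => E (Δ n) x) (E (⋃ n, Δ n) x)) ∧
  ∀ x : H, ∃ μ : Measure ℝ, IsFiniteMeasure μ ∧
    (∀ Δ : Set ℝ, MeasurableSet Δ → (μ Δ).toReal = (⟪x, E Δ x⟫_ℂ).re) ∧
    ∀ f : ℝ → ℝ, Continuous f → (⟪x, cfc f A x⟫_ℂ).re = ∫ t, f t ∂μ

/-- An indefinite integral `𝒥(χ_Δ)` of the characteristic function of `Δ`. -/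
noncomputable def Jind (a : ℝ) (Δ : Set ℝ) (t : ℝ) : ℝ :=
  ∫ s in a..t, Set.indicator Δ (fun _ => (1 : ℝ)) s

/-- `𝒥(χ_Δ)(A)`. -/
noncomputable def JindOp (a : ℝ) (Δ : Set ℝ) (A : H →L[ℂ] H) : H →L[ℂ] H :=
  fc (fun t => (Jind a Δ t : ℂ)) A

/-- `ψ ∈ C¹([a,b])` with derivative `ψd` on `[a,b]`. -/
def HasDerivOnIcc (ψ ψd : ℝ → ℂ) (a b : ℝ) : Prop :=
  (∀ t ∈ Set.Icc a b, HasDerivWithinAt ψ (ψd t) (Set.Icc a b) t) ∧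
  ContinuousOn ψd (Set.Icc a b)

/-- `r` is a Carey–Pincus principal function for the pair `X, Y`: a nonnegative
`L¹([a,b]²)` function with `Tr(−i[ψ(Y), φ(X)]) = ∫∫ φ′(t) ψ′(λ) r(t,λ) dt dλ`
for all `ψ, φ ∈ C¹([a,b])`. -/
def IsPrincipalFunction {ι : Type*} (e : HilbertBasis ι ℂ H) (X Y : H →L[ℂ] H)
    (a b : ℝ) (r : ℝ → ℝ → ℝ) : Prop :=
  IntegrableOn (fun q : ℝ × ℝ => r q.1 q.2) (Set.Icc a b ×ˢ Set.Icc a b) ∧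
  (∀ᵐ q : ℝ × ℝ ∂(volume : Measure (ℝ × ℝ)),
    q ∈ Set.Icc a b ×ˢ Set.Icc a b → 0 ≤ r q.1 q.2) ∧
  ∀ ψ ψd φ φd : ℝ → ℂ, HasDerivOnIcc ψ ψd a b → HasDerivOnIcc φ φd a b →
    trace e ((-Complex.I) • (fc ψ Y * fc φ X - fc φ X * fc ψ Y)) =
      ∫ t in Set.Icc a b, ∫ l in Set.Icc a b, φd t * ψd l * (r t l : ℂ)

/-- The Jacobian `J(F,G)(t,λ) = ∂F/∂t ∂G/∂λ − ∂F/∂λ ∂G/∂t`. -/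
noncomputable def Jac (F G : ℝ → ℝ → ℂ) (t l : ℝ) : ℂ :=
  deriv (fun s => F s l) t * deriv (fun s => G t s) l -
    deriv (fun s => F t s) l * deriv (fun s => G s l) t

section aux

/-- Hilbert–Schmidt operators relative to the basis `e`. -/
def HS {ι : Type*} (e : HilbertBasis ι ℂ H) (A : H →L[ℂ] H) : Prop :=
  Summable fun i => ‖A (e i)‖ ^ 2

/-- Finite linear combinations of products of two Hilbert–Schmidt operators. -/
def TC {ι : Type*} (e : HilbertBasis ι ℂ H) : Submodule ℂ (H →L[ℂ] H) :=
  Submodule.span ℂ {A | ∃ P Q : H →L[ℂ] H, HS e P ∧ HS e Q ∧ A = P * Q}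

variable {ι : Type*} (e : HilbertBasis ι ℂ H)

theorem hasSum_norm_sq (x : H) : HasSum (fun i => ‖⟪e i, x⟫_ℂ‖ ^ 2) (‖x‖ ^ 2) := by
  have h := e.hasSum_inner_mul_inner x x
  have h2 := Complex.hasSum_re h
  convert h2 using 1
  · ext i
    rw [← inner_conj_symm x (e i), Complex.conj_mul']
    norm_cast
  · rw [inner_self_eq_norm_sq_to_K]
    norm_cast

theorem HS_iff (A : H →L[ℂ] H) :
    HS e A ↔ Summable fun p : ι × ι => ‖⟪e p.2, A (e p.1)⟫_ℂ‖ ^ 2 := by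
  rw [summable_prod_of_nonneg (fun p => by positivity)]
  simp only [(hasSum_norm_sq e _).tsum_eq]
  exact ⟨fun h => ⟨fun i => (hasSum_norm_sq e _).summable, h⟩, fun h => h.2⟩

theorem HS.star {A : H →L[ℂ] H} (h : HS e A) : HS e (ContinuousLinearMap.adjoint A) := by
  rw [HS_iff] at h ⊢
  rw [← (Equiv.prodComm ι ι).summable_iff] at h
  refine h.congr fun p => ?_
  simp only [Function.comp, Equiv.prodComm_apply, Prod.fst_swap, Prod.snd_swap]
  rw [ContinuousLinearMap.adjoint_inner_right, ← inner_conj_symm, RCLike.norm_conj]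

theorem HS.mul_left {A : H →L[ℂ] H} (h : HS e A) (B : H →L[ℂ] H) : HS e (B * A) := by
  refine Summable.of_nonneg_of_le (fun i => by positivity) (fun i => ?_) (Summable.mul_left (‖B‖ ^ 2) h)
  rw [← mul_pow]
  exact pow_le_pow_left₀ (norm_nonneg _) (B.le_opNorm _) 2

theorem HS.mul_right {A : H →L[ℂ] H} (h : HS e A) (B : H →L[ℂ] H) : HS e (A * B) := by
  have h1 := (HS.mul_left e (HS.star e h) (ContinuousLinearMap.adjoint B)).star
  have h2 : ContinuousLinearMap.adjoint
      (ContinuousLinearMap.adjoint B * ContinuousLinearMap.adjoint A) = A * B := by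
    simp only [← ContinuousLinearMap.star_eq_adjoint, star_mul, star_star]
  rwa [h2] at h1

/-- the double series behind the trace of a product. -/
theorem HS.summable_prod {P Q : H →L[ℂ] H} (hP : HS e P) (hQ : HS e Q) :
    Summable fun p : ι × ι => ⟪e p.1, P (e p.2)⟫_ℂ * ⟪e p.2, Q (e p.1)⟫_ℂ := by
  rw [HS_iff] at hP hQ
  have hP' := ((Equiv.prodComm ι ι).summable_iff).2 hP
  refine Summable.of_norm_bounded (hP'.add hQ) fun p => ?_
  simp only [Function.comp, Equiv.prodComm_apply, Prod.fst_swap, Prod.snd_swap, norm_mul]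
  nlinarith [sq_nonneg (‖⟪e p.1, P (e p.2)⟫_ℂ‖ - ‖⟪e p.2, Q (e p.1)⟫_ℂ‖),
    sq_nonneg (‖⟪e p.1, P (e p.2)⟫_ℂ‖), sq_nonneg (‖⟪e p.2, Q (e p.1)⟫_ℂ‖)]

theorem hasSum_inner_prod (P Q : H →L[ℂ] H) (i : ι) :
    HasSum (fun j => ⟪e i, P (e j)⟫_ℂ * ⟪e j, Q (e i)⟫_ℂ) ⟪e i, (P * Q) (e i)⟫_ℂ := by
  have h := e.hasSum_inner_mul_inner (ContinuousLinearMap.adjoint P (e i)) (Q (e i))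
  simp only [ContinuousLinearMap.adjoint_inner_left] at h
  exact h

theorem HS.summable_diag {P Q : H →L[ℂ] H} (hP : HS e P) (hQ : HS e Q) :
    Summable fun i => ⟪e i, (P * Q) (e i)⟫_ℂ := by
  have h := (HS.summable_prod e hP hQ).prod
  simpa only [(hasSum_inner_prod e P Q _).tsum_eq] using h

theorem HS.trace_eq {P Q : H →L[ℂ] H} (hP : HS e P) (hQ : HS e Q) :
    trace e (P * Q) = ∑' p : ι × ι, ⟪e p.1, P (e p.2)⟫_ℂ * ⟪e p.2, Q (e p.1)⟫_ℂ := by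
  have h := (HS.summable_prod e hP hQ).tsum_prod
  simp only [(hasSum_inner_prod e P Q _).tsum_eq] at h
  exact h.symm

theorem HS.trace_comm {P Q : H →L[ℂ] H} (hP : HS e P) (hQ : HS e Q) :
    trace e (P * Q) = trace e (Q * P) := by
  rw [HS.trace_eq e hP hQ, HS.trace_eq e hQ hP, ← (Equiv.prodComm ι ι).tsum_eq]
  refine tsum_congr fun p => ?_
  simp only [Equiv.prodComm_apply, Prod.fst_swap, Prod.snd_swap]
  ring

theorem TC.summable_diag {A : H →L[ℂ] H} (h : A ∈ TC e) :
    Summable fun i => ⟪e i, A (e i)⟫_ℂ := by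
  induction h using Submodule.span_induction with
  | mem x hx => obtain ⟨P, Q, hP, hQ, rfl⟩ := hx; exact HS.summable_diag e hP hQ
  | zero => simpa using summable_zero
  | add x y _ _ hx hy => simpa [inner_add_right] using hx.add hy
  | smul c x _ hx => simpa [inner_smul_right] using hx.mul_left c

theorem trace_add {A B : H →L[ℂ] H} (hA : A ∈ TC e) (hB : B ∈ TC e) :
    trace e (A + B) = trace e A + trace e B := by
  unfold trace
  rw [← (TC.summable_diag e hA).tsum_add (TC.summable_diag e hB)]
  simp [inner_add_right]

theorem trace_smul (c : ℂ) (A : H →L[ℂ] H) :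
    trace e (c • A) = c * trace e A := by
  unfold trace
  rw [← tsum_mul_left]
  simp [inner_smul_right]

theorem TC.mul_left {A : H →L[ℂ] H} (h : A ∈ TC e) (B : H →L[ℂ] H) : B * A ∈ TC e := by
  induction h using Submodule.span_induction with
  | mem x hx =>
    obtain ⟨P, Q, hP, hQ, rfl⟩ := hx
    exact Submodule.subset_span ⟨B * P, Q, HS.mul_left e hP B, hQ, (mul_assoc _ _ _).symm⟩
  | zero => simp
  | add x y _ _ hx hy => rw [mul_add]; exact add_mem hx hy
  | smul c x _ hx => rw [mul_smul_comm]; exact Submodule.smul_mem _ c hx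

theorem TC.mul_right {A : H →L[ℂ] H} (h : A ∈ TC e) (B : H →L[ℂ] H) : A * B ∈ TC e := by
  induction h using Submodule.span_induction with
  | mem x hx =>
    obtain ⟨P, Q, hP, hQ, rfl⟩ := hx
    exact Submodule.subset_span ⟨P, Q * B, hP, HS.mul_right e hQ B, mul_assoc _ _ _⟩
  | zero => simp
  | add x y _ _ hx hy => rw [add_mul]; exact add_mem hx hy
  | smul c x _ hx => rw [smul_mul_assoc]; exact Submodule.smul_mem _ c hx

theorem TC.trace_comm {A : H →L[ℂ] H} (h : A ∈ TC e) (B : H →L[ℂ] H) :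
    trace e (A * B) = trace e (B * A) := by
  induction h using Submodule.span_induction with
  | mem x hx =>
    obtain ⟨P, Q, hP, hQ, rfl⟩ := hx
    rw [mul_assoc, HS.trace_comm e hP (HS.mul_right e hQ B), mul_assoc,
      HS.trace_comm e hQ (HS.mul_left e hP B), mul_assoc]
  | zero => simp
  | add x y hx' hy' hx hy =>
    rw [mul_add, add_mul, trace_add e (TC.mul_right e hx' B) (TC.mul_right e hy' B),
      trace_add e (TC.mul_left e hx' B) (TC.mul_left e hy' B), hx, hy]
  | smul c x _ hx => rw [mul_smul_comm, smul_mul_assoc, trace_smul, trace_smul, hx]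

theorem absOp_eq (A : H →L[ℂ] H) : absOp A = CFC.abs A := by
  unfold absOp CFC.abs
  rw [CFC.sqrt_eq_real_sqrt _ (star_mul_self_nonneg A), cfcₙ_eq_cfc,
    ContinuousLinearMap.star_eq_adjoint]

theorem norm_absOp (A : H →L[ℂ] H) (x : H) : ‖absOp A x‖ = ‖A x‖ := by
  have h1 : absOp A * absOp A = ContinuousLinearMap.adjoint A * A := by
    rw [absOp_eq, CFC.abs_mul_abs, ContinuousLinearMap.star_eq_adjoint]
  have h2 : ContinuousLinearMap.adjoint (absOp A) = absOp A := by
    rw [absOp_eq, ← ContinuousLinearMap.star_eq_adjoint]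
    exact (CFC.abs_nonneg A).isSelfAdjoint.star_eq
  have h3 : ⟪absOp A x, absOp A x⟫_ℂ = ⟪A x, A x⟫_ℂ := by
    rw [← ContinuousLinearMap.adjoint_inner_right, h2, ← ContinuousLinearMap.adjoint_inner_right]
    exact congrArg (fun S : H →L[ℂ] H => ⟪x, S x⟫_ℂ) h1
  rw [inner_self_eq_norm_sq_to_K, inner_self_eq_norm_sq_to_K] at h3
  have h4 : ‖absOp A x‖ ^ 2 = ‖A x‖ ^ 2 := by exact_mod_cast h3
  exact (pow_left_inj₀ (norm_nonneg _) (norm_nonneg _) two_ne_zero).1 h4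

/-- Half of the polar decomposition. -/
theorem exists_polar (A : H →L[ℂ] H) : ∃ W : H →L[ℂ] H, absOp A = W * A := by
  let M : Submodule ℂ H := (LinearMap.range (A : H →ₗ[ℂ] H)).topologicalClosure
  have hM : ∀ x, (A : H →ₗ[ℂ] H) x ∈ M := fun x =>
    Submodule.le_topologicalClosure _ (LinearMap.mem_range_self _ x)
  let g : H →ₗ[ℂ] M := (A : H →ₗ[ℂ] H).codRestrict M hM
  have hdense : DenseRange g := by
    intro y
    rw [closure_subtype]
    have hy : (y : H) ∈ closure (LinearMap.range (A : H →ₗ[ℂ] H) : Set H) := by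
      have := y.2
      rwa [← SetLike.mem_coe, Submodule.topologicalClosure_coe] at this
    refine closure_mono ?_ hy
    rintro _ ⟨x, rfl⟩
    exact ⟨g x, ⟨x, rfl⟩, rfl⟩
  have hM' : IsClosed (M : Set H) := Submodule.isClosed_topologicalClosure _
  haveI : CompleteSpace M := hM'.completeSpace_coe
  let f : H →ₗ[ℂ] H := (absOp A : H →L[ℂ] H)
  have hn : ∃ C : ℝ, ∀ x, ‖f x‖ ≤ C * ‖g x‖ :=
    ⟨1, fun x => by rw [one_mul]; exact (norm_absOp A x).le⟩
  refine ⟨(f.extendOfNorm g).comp M.orthogonalProjectionOnto, ?_⟩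
  ext x
  have h1 : M.orthogonalProjectionOnto (A x) = g x :=
    Submodule.orthogonalProjectionOnto_mem_subspace_eq_self (g x)
  change absOp A x = f.extendOfNorm g (M.orthogonalProjectionOnto (A x))
  rw [h1, LinearMap.extendOfNorm_eq hdense hn]
  rfl

theorem TC.isTraceClass {A : H →L[ℂ] H} (h : A ∈ TC e) : IsTraceClass e A := by
  obtain ⟨W, hW⟩ := exists_polar A
  have h1 := TC.summable_diag e (TC.mul_left e h W)
  unfold IsTraceClass
  rw [hW]
  exact (Complex.hasSum_re h1.hasSum).summable

theorem TC.of_pos {D : H →L[ℂ] H} (hpos : D.IsPositive) (h : IsTraceClass e D) : D ∈ TC e := by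
  have h0 : 0 ≤ D := (ContinuousLinearMap.nonneg_iff_isPositive D).2 hpos
  have hS : HS e (CFC.sqrt D) := by
    unfold IsTraceClass at h
    rw [absOp_eq, CFC.abs_of_nonneg D h0] at h
    refine h.congr fun i => ?_
    have h2 : ContinuousLinearMap.adjoint (CFC.sqrt D) = CFC.sqrt D := by
      rw [← ContinuousLinearMap.star_eq_adjoint]
      exact (CFC.sqrt_nonneg D).isSelfAdjoint.star_eq
    have h3 : ⟪e i, D (e i)⟫_ℂ = ⟪CFC.sqrt D (e i), CFC.sqrt D (e i)⟫_ℂ := by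
      rw [← ContinuousLinearMap.adjoint_inner_right, h2]
      exact congrArg (fun S : H →L[ℂ] H => ⟪e i, S (e i)⟫_ℂ) (CFC.sqrt_mul_sqrt_self D h0).symm
    rw [h3, inner_self_eq_norm_sq_to_K]
    norm_cast
  exact Submodule.subset_span ⟨_, _, hS, hS, (CFC.sqrt_mul_sqrt_self D h0).symm⟩

/-- The derivation property of the commutator under the trace. -/
theorem comm_poly {A B : H →L[ℂ] H} (h : A * B - B * A ∈ TC e) (p : Polynomial ℂ) :
    A * aeval B p - aeval B p * A ∈ TC e ∧
    ∀ q : Polynomial ℂ, trace e (aeval B q * (A * aeval B p - aeval B p * A)) =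
      trace e (aeval B (q * derivative p) * (A * B - B * A)) := by
  have hmul : ∀ p₁ p₂ : Polynomial ℂ,
      (A * aeval B p₁ - aeval B p₁ * A ∈ TC e ∧
        ∀ q : Polynomial ℂ, trace e (aeval B q * (A * aeval B p₁ - aeval B p₁ * A)) =
        trace e (aeval B (q * derivative p₁) * (A * B - B * A))) →
      (A * aeval B p₂ - aeval B p₂ * A ∈ TC e ∧
        ∀ q : Polynomial ℂ, trace e (aeval B q * (A * aeval B p₂ - aeval B p₂ * A)) =
        trace e (aeval B (q * derivative p₂) * (A * B - B * A))) →
      (A * aeval B (p₁ * p₂) - aeval B (p₁ * p₂) * A ∈ TC e ∧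
        ∀ q : Polynomial ℂ, trace e (aeval B q *
          (A * aeval B (p₁ * p₂) - aeval B (p₁ * p₂) * A)) =
        trace e (aeval B (q * derivative (p₁ * p₂)) * (A * B - B * A))) := by
    rintro p₁ p₂ ⟨h1, h1'⟩ ⟨h2, h2'⟩
    have heq : A * aeval B (p₁ * p₂) - aeval B (p₁ * p₂) * A =
        (A * aeval B p₁ - aeval B p₁ * A) * aeval B p₂ +
          aeval B p₁ * (A * aeval B p₂ - aeval B p₂ * A) := by
      rw [map_mul]; noncomm_ring
    rw [heq]
    refine ⟨add_mem (TC.mul_right e h1 _) (TC.mul_left e h2 _), fun q => ?_⟩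
    rw [mul_add, trace_add e (TC.mul_left e (TC.mul_right e h1 _) _)
      (TC.mul_left e (TC.mul_left e h2 _) _), ← mul_assoc,
      TC.trace_comm e (TC.mul_left e h1 _), ← mul_assoc, ← mul_assoc (aeval B q), ← map_mul,
      ← map_mul, h1', h2', ← trace_add e (TC.mul_left e h _) (TC.mul_left e h _), ← add_mul,
      ← map_add]
    congr 3
    rw [derivative_mul]; ring
  have hC : ∀ c : ℂ, (A * aeval B (C c) - aeval B (C c) * A ∈ TC e ∧
        ∀ q : Polynomial ℂ, trace e (aeval B q * (A * aeval B (C c) - aeval B (C c) * A)) =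
        trace e (aeval B (q * derivative (C c)) * (A * B - B * A))) := by
    intro c
    have : A * aeval B (C c) - aeval B (C c) * A = 0 := by
      rw [aeval_C, Algebra.commutes, sub_self]
    rw [this]
    simp
  induction p using Polynomial.induction_on with
  | C c => exact hC c
  | add p q hp hq =>
    have heq : A * aeval B (p + q) - aeval B (p + q) * A =
        (A * aeval B p - aeval B p * A) + (A * aeval B q - aeval B q * A) := by
      rw [map_add]; noncomm_ring
    rw [heq]
    refine ⟨add_mem hp.1 hq.1, fun s => ?_⟩
    rw [mul_add, trace_add e (TC.mul_left e hp.1 _) (TC.mul_left e hq.1 _), hp.2, hq.2,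
      ← trace_add e (TC.mul_left e h _) (TC.mul_left e h _), ← add_mul, ← map_add,
      derivative_add, mul_add]
  | monomial n c ih =>
    rw [pow_succ, ← mul_assoc]
    refine hmul _ _ ih ?_
    simpa using h

theorem exists_antideriv (p : Polynomial ℂ) : ∃ P : Polynomial ℂ, derivative P = p := by
  induction p using Polynomial.induction_on' with
  | add p q hp hq =>
    obtain ⟨P, rfl⟩ := hp
    obtain ⟨Q, rfl⟩ := hq
    exact ⟨P + Q, derivative_add⟩
  | monomial n c =>
    refine ⟨monomial (n + 1) (c / (n + 1)), ?_⟩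
    rw [derivative_monomial]
    have : (n : ℂ) + 1 ≠ 0 := by exact_mod_cast n.succ_ne_zero
    simp only [Nat.add_sub_cancel, Nat.cast_add, Nat.cast_one]
    rw [div_mul_cancel₀ _ this]

theorem fc_poly {A : H →L[ℂ] H} (hA : IsSelfAdjoint A) (p : Polynomial ℂ) :
    fc (fun t => p.eval (t : ℂ)) A = aeval A p := by
  have hn : IsStarNormal A := hA.isStarNormal
  rw [← cfc_polynomial p A hn]
  unfold fc
  refine cfc_congr fun z hz => ?_
  simp only
  rw [← hA.mem_spectrum_eq_re hz]

theorem hasDerivAt_poly (p : Polynomial ℂ) (t : ℝ) :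
    HasDerivAt (fun s : ℝ => p.eval (s : ℂ)) ((derivative p).eval (t : ℂ)) t :=
  (p.hasDerivAt (t : ℂ)).comp_ofReal

theorem hasDerivOnIcc_poly (p : Polynomial ℂ) (a b : ℝ) :
    HasDerivOnIcc (fun t : ℝ => p.eval (t : ℂ)) (fun t => (derivative p).eval (t : ℂ)) a b :=
  ⟨fun t _ => (hasDerivAt_poly p t).hasDerivWithinAt,
    ((derivative p).continuous.comp Complex.continuous_ofReal).continuousOn⟩

end aux

theorem statement17 {ι : Type*} (e : HilbertBasis ι ℂ H) (X Y D2 : H →L[ℂ] H)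
    (a b : ℝ) (hA : AssumptionA e X Y D2 a b)
    (r : ℝ → ℝ → ℝ) (hr : IsPrincipalFunction e X Y a b r)
    (α ψ φ β : Polynomial ℂ) :
    IsTraceClass e (aeval X α * aeval Y ψ * aeval X φ -
      aeval X φ * (aeval X α * aeval Y ψ)) ∧
    IsTraceClass e (aeval X α * aeval Y ψ * aeval Y β -
      aeval Y β * (aeval X α * aeval Y ψ)) ∧
    (-Complex.I) * trace e (aeval X α * aeval Y ψ * aeval X φ -
        aeval X φ * (aeval X α * aeval Y ψ)) =
      ∫ t in Set.Icc a b, ∫ l in Set.Icc a b,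
        Polynomial.eval (t : ℂ) α * Polynomial.eval (t : ℂ) (derivative φ) *
          Polynomial.eval (l : ℂ) (derivative ψ) * (r t l : ℂ) ∧
    (-Complex.I) * trace e (aeval X α * aeval Y ψ * aeval X φ -
        aeval X φ * (aeval X α * aeval Y ψ)) =
      ∫ t in Set.Icc a b, ∫ l in Set.Icc a b,
        -(Jac (fun s u => Polynomial.eval (s : ℂ) α * Polynomial.eval (u : ℂ) ψ)
            (fun s _ => Polynomial.eval (s : ℂ) φ) t l) * (r t l : ℂ) ∧
    (-Complex.I) * trace e (aeval X α * aeval Y ψ * aeval Y β -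
        aeval Y β * (aeval X α * aeval Y ψ)) =
      -∫ t in Set.Icc a b, ∫ l in Set.Icc a b,
        Polynomial.eval (t : ℂ) (derivative α) * Polynomial.eval (l : ℂ) ψ *
          Polynomial.eval (l : ℂ) (derivative β) * (r t l : ℂ) ∧
    (-Complex.I) * trace e (aeval X α * aeval Y ψ * aeval Y β -
        aeval Y β * (aeval X α * aeval Y ψ)) =
      ∫ t in Set.Icc a b, ∫ l in Set.Icc a b,
        -(Jac (fun s u => Polynomial.eval (s : ℂ) α * Polynomial.eval (u : ℂ) ψ)
            (fun _ u => Polynomial.eval (u : ℂ) β) t l) * (r t l : ℂ) := by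
  have hD : Y * X - X * Y = Complex.I • D2 := by
    have h := congrArg (fun Z : H →L[ℂ] H => (Complex.I / 2) • Z) hA.hD2
    simp only [smul_smul] at h
    have h1 : Complex.I / 2 * (-2 * Complex.I) = 1 := by
      linear_combination -Complex.I_mul_I
    have h2 : Complex.I / 2 * 2 = Complex.I := by ring
    rw [h1, h2, one_smul] at h
    exact h.symm
  have hK : Y * X - X * Y ∈ TC e := by
    rw [hD]; exact Submodule.smul_mem _ _ (TC.of_pos e hA.hpos hA.htc)
  have hK' : X * Y - Y * X ∈ TC e := by
    rw [← neg_sub]; exact neg_mem hK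
  -- principal function formula for polynomials
  have hpf : ∀ p q : Polynomial ℂ,
      (-Complex.I) * trace e (aeval Y p * aeval X q - aeval X q * aeval Y p) =
      ∫ t in Set.Icc a b, ∫ l in Set.Icc a b, (derivative q).eval (t : ℂ) *
        (derivative p).eval (l : ℂ) * (r t l : ℂ) := by
    intro p q
    have h := hr.2.2 _ _ _ _ (hasDerivOnIcc_poly p a b) (hasDerivOnIcc_poly q a b)
    rwa [fc_poly hA.hY, fc_poly hA.hX, trace_smul] at h
  -- commutators of a polynomial in one variable with the other variable
  have hψX : aeval Y ψ * X - X * aeval Y ψ ∈ TC e := by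
    rw [← neg_sub]; exact neg_mem (comm_poly e hK' ψ).1
  have hαY : aeval X α * Y - Y * aeval X α ∈ TC e := by
    rw [← neg_sub]; exact neg_mem (comm_poly e hK α).1
  have e1 : aeval X α * aeval Y ψ * aeval X φ - aeval X φ * (aeval X α * aeval Y ψ) =
      aeval X α * (aeval Y ψ * aeval X φ - aeval X φ * aeval Y ψ) := by
    rw [mul_sub, ← mul_assoc, ← mul_assoc, ← mul_assoc, ← map_mul, ← map_mul, mul_comm φ α]
  have e2 : aeval X α * aeval Y ψ * aeval Y β - aeval Y β * (aeval X α * aeval Y ψ) =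
      (aeval X α * aeval Y β - aeval Y β * aeval X α) * aeval Y ψ := by
    rw [sub_mul, mul_assoc, mul_assoc, mul_assoc, ← map_mul, ← map_mul, mul_comm ψ β]
  have t1 : aeval Y ψ * aeval X φ - aeval X φ * aeval Y ψ ∈ TC e := (comm_poly e hψX φ).1
  have t2 : aeval X α * aeval Y β - aeval Y β * aeval X α ∈ TC e := (comm_poly e hαY β).1
  have m1 : (-Complex.I) * trace e (aeval X α * aeval Y ψ * aeval X φ -
        aeval X φ * (aeval X α * aeval Y ψ)) =
      ∫ t in Set.Icc a b, ∫ l in Set.Icc a b,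
        Polynomial.eval (t : ℂ) α * Polynomial.eval (t : ℂ) (derivative φ) *
          Polynomial.eval (l : ℂ) (derivative ψ) * (r t l : ℂ) := by
    obtain ⟨Φ, hΦ⟩ := exists_antideriv (α * derivative φ)
    have h1 := hpf ψ Φ
    have h2 := (comm_poly e hψX Φ).2 1
    rw [map_one, one_mul, one_mul, hΦ] at h2
    rw [h2, hΦ] at h1
    rw [e1, (comm_poly e hψX φ).2 α, h1]
    simp only [eval_mul]
  have m2 : (-Complex.I) * trace e (aeval X α * aeval Y ψ * aeval Y β -
        aeval Y β * (aeval X α * aeval Y ψ)) =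
      -∫ t in Set.Icc a b, ∫ l in Set.Icc a b,
        Polynomial.eval (t : ℂ) (derivative α) * Polynomial.eval (l : ℂ) ψ *
          Polynomial.eval (l : ℂ) (derivative β) * (r t l : ℂ) := by
    obtain ⟨B, hB⟩ := exists_antideriv (ψ * derivative β)
    have h1 := hpf B α
    have h2 := (comm_poly e hαY B).2 1
    rw [map_one, one_mul, one_mul, hB] at h2
    have h3 : aeval Y B * aeval X α - aeval X α * aeval Y B =
        (-1 : ℂ) • (aeval X α * aeval Y B - aeval Y B * aeval X α) := by
      rw [neg_one_smul, neg_sub]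
    rw [h3, trace_smul, h2, hB] at h1
    rw [e2, TC.trace_comm e t2, (comm_poly e hαY β).2 ψ]
    simp only [eval_mul, ← mul_assoc] at h1 ⊢
    rw [← h1]; ring
  refine ⟨?_, ?_, m1, ?_, m2, ?_⟩
  · rw [e1]; exact TC.isTraceClass e (TC.mul_left e t1 _)
  · rw [e2]; exact TC.isTraceClass e (TC.mul_right e t2 _)
  · rw [m1]
    congr 1; ext t; congr 1; ext l
    unfold Jac
    rw [deriv_const, (hasDerivAt_poly φ t).deriv, ((hasDerivAt_poly ψ l).const_mul _).deriv]
    ring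
  · rw [m2, ← integral_neg]
    congr 1; ext t; rw [← integral_neg]; congr 1; ext l
    unfold Jac
    rw [deriv_const, (hasDerivAt_poly β l).deriv, ((hasDerivAt_poly α t).mul_const _).deriv]
    ring

end HHCP
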